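/- Let d, T, J, I ≥ 1. Suppose given vectors w_{t,j} ∈ ℝ^d for (t,j) ∈ [T]×[J] and x_{t,i} ∈ ℝ^d for (t,i) ∈ [T]×[I], weights p_t : [I] → ℝ with p_t(i) ≥ 0 and Σ_{i} p_t(i) = 1 for every t, and reals γ_t ≥ 0, R_x ≥ 0, R_w ≥ 0 such that for every t ∈ [T]: (i) Σ_{s=1}^{t−1} Σ_{i} p_s(i)·( Σ_{j=1}^{J} |⟨w_{t,j}, x_{s,i}⟩| )² ≤ γ_t; (ii) Σ_{i} p_t(i)·‖x_{t,i}‖₂² ≤ R_x²; and (iii) Σ_{j=1}^{J} ‖w_{t,j}‖₂ ≤ R_w. Then for every R > 0, Σ_{t=1}^{T} min{ R , Σ_{i} p_t(i)·Σ_{j=1}^{J} |⟨w_{t,j}, x_{t,i}⟩| } ≤ √( 2·d·( R²·T + Σ_{t=1}^{T} γ_t )·log(1 + T·R_x²·R_w² / R²) ). -/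

import Mathlib

open Finset Real Matrix

theorem Finset.one_add_sum_le_prod_one_add {ι : Type*} {s : Finset ι} {f : ι → ℝ}
    (hf : ∀ i ∈ s, 0 ≤ f i) : 1 + ∑ i ∈ s, f i ≤ ∏ i ∈ s, (1 + f i) := by
  classical
  induction s using Finset.induction_on with
  | empty => simp
  | insert i s hi ih =>
    rw [Finset.forall_mem_insert] at hf
    rw [Finset.sum_insert hi, Finset.prod_insert hi]
    nlinarith [ih hf.2, hf.1, mul_nonneg hf.1 (Finset.sum_nonneg hf.2)]

theorem Matrix.PosSemidef.sq_dotProduct_mulVec_le {n : Type*} [Fintype n] {V : Matrix n n ℝ}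
    (hV : V.PosSemidef) (v y : n → ℝ) : (v ⬝ᵥ V *ᵥ y) ^ 2 ≤ (v ⬝ᵥ V *ᵥ v) * (y ⬝ᵥ V *ᵥ y) := by
  have hsymm : y ⬝ᵥ V *ᵥ v = v ⬝ᵥ V *ᵥ y := by
    have hT : Vᵀ = V := by
      rw [← Matrix.conjTranspose_eq_transpose_of_trivial]
      exact hV.isHermitian.eq
    rw [Matrix.dotProduct_mulVec, ← Matrix.mulVec_transpose, hT, dotProduct_comm]
  have h := discrim_le_zero (a := y ⬝ᵥ V *ᵥ y) (b := 2 * (v ⬝ᵥ V *ᵥ y)) (c := v ⬝ᵥ V *ᵥ v)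
    (fun t => by
      have := hV.dotProduct_mulVec_nonneg (v + t • y)
      simp only [star_trivial, Matrix.mulVec_add, Matrix.mulVec_smul, add_dotProduct,
        dotProduct_add, smul_dotProduct, dotProduct_smul, smul_eq_mul, hsymm] at this
      linarith)
  simp only [discrim] at h
  linarith

theorem posDef_one_add_sum {n : Type*} [DecidableEq n] {A : ℕ → Matrix n n ℝ} {s : Finset ℕ}
    (hA : ∀ t ∈ s, (A t).PosSemidef) : (1 + ∑ t ∈ s, A t).PosDef :=
  Matrix.PosDef.one.add_posSemidef (Matrix.posSemidef_sum s hA)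

section Determinant

variable {n : Type*} [Fintype n] [DecidableEq n]

theorem Matrix.IsHermitian.det_one_add {M : Matrix n n ℝ} (hM : M.IsHermitian) :
    (1 + M).det = ∏ i, (1 + hM.eigenvalues i) := by
  have h := congrArg (Polynomial.eval (-1)) hM.charpoly_eq
  rw [Matrix.eval_charpoly, Polynomial.eval_prod] at h
  have h' : Matrix.scalar n (-1 : ℝ) - M = -(1 + M) := by
    rw [map_neg, map_one]; abel
  rw [h', Matrix.det_neg] at h
  have h2 : ∀ i, Polynomial.eval (-1 : ℝ)
      (Polynomial.X - Polynomial.C ((hM.eigenvalues i : ℝ))) = -1 * (1 + hM.eigenvalues i) := by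
    intro i; simp; ring
  simp only [RCLike.ofReal_real_eq_id, id, h2, Finset.prod_mul_distrib, Finset.prod_const,
    Finset.card_univ] at h
  exact mul_left_cancel₀ (pow_ne_zero _ (by norm_num)) h

theorem Matrix.PosSemidef.one_add_trace_le_det {M : Matrix n n ℝ} (hM : M.PosSemidef) :
    1 + M.trace ≤ (1 + M).det := by
  rw [hM.isHermitian.det_one_add, hM.isHermitian.trace_eq_sum_eigenvalues]
  exact Finset.one_add_sum_le_prod_one_add fun i _ => hM.eigenvalues_nonneg i

theorem Matrix.PosSemidef.det_one_add_le {M : Matrix n n ℝ} (hM : M.PosSemidef) :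
    (1 + M).det ≤ (1 + M.trace) ^ Fintype.card n := by
  rw [hM.isHermitian.det_one_add, hM.isHermitian.trace_eq_sum_eigenvalues,
    ← Finset.card_univ, ← Finset.prod_const]
  refine Finset.prod_le_prod (fun i _ => ?_) (fun i _ => ?_)
  · linarith [hM.eigenvalues_nonneg i]
  · simpa using Finset.single_le_sum (fun i _ => hM.eigenvalues_nonneg i) (mem_univ i)

open scoped MatrixOrder in
theorem Matrix.PosSemidef.exists_eq_conjTranspose_mul_self {A : Matrix n n ℝ}
    (hA : A.PosSemidef) : ∃ B : Matrix n n ℝ, A = Bᴴ * B :=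
  CStarAlgebra.nonneg_iff_eq_star_mul_self.mp hA.nonneg

theorem Matrix.PosSemidef.trace_mul_nonneg {M A : Matrix n n ℝ} (hM : M.PosSemidef)
    (hA : A.PosSemidef) : 0 ≤ (M * A).trace := by
  obtain ⟨B, rfl⟩ := hA.exists_eq_conjTranspose_mul_self
  rw [← Matrix.mul_assoc, Matrix.trace_mul_comm, ← Matrix.mul_assoc]
  exact (hM.mul_mul_conjTranspose_same B).trace_nonneg

theorem Matrix.PosDef.det_mul_one_add_trace_le {V A : Matrix n n ℝ} (hV : V.PosDef)
    (hA : A.PosSemidef) : V.det * (1 + (V⁻¹ * A).trace) ≤ (V + A).det := by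
  obtain ⟨B, rfl⟩ := hA.exists_eq_conjTranspose_mul_self
  have hu : IsUnit V.det := (Matrix.isUnit_iff_isUnit_det V).mp hV.isUnit
  have h1 : V + Bᴴ * B = V * (1 + V⁻¹ * Bᴴ * B) := by
    rw [mul_add, mul_one, Matrix.mul_assoc, Matrix.mul_nonsing_inv_cancel_left _ _ hu]
  rw [h1, Matrix.det_mul, Matrix.det_one_add_mul_comm, ← Matrix.mul_assoc,
    Matrix.trace_mul_comm, ← Matrix.mul_assoc]
  refine mul_le_mul_of_nonneg_left ?_ hV.det_pos.le
  exact (hV.inv.posSemidef.mul_mul_conjTranspose_same B).one_add_trace_le_det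

theorem Matrix.PosDef.sq_dotProduct_le {V : Matrix n n ℝ} (hV : V.PosDef) (v y : n → ℝ) :
    (v ⬝ᵥ y) ^ 2 ≤ (v ⬝ᵥ V *ᵥ v) * (y ⬝ᵥ V⁻¹ *ᵥ y) := by
  have hu : IsUnit V.det := (Matrix.isUnit_iff_isUnit_det V).mp hV.isUnit
  have h : V *ᵥ (V⁻¹ *ᵥ y) = y := by
    rw [Matrix.mulVec_mulVec, Matrix.mul_nonsing_inv _ hu, Matrix.one_mulVec]
  have := hV.posSemidef.sq_dotProduct_mulVec_le v (V⁻¹ *ᵥ y)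
  rwa [h, dotProduct_comm (V⁻¹ *ᵥ y)] at this

/-- The elliptical potential lemma for positive semidefinite increments. -/
theorem sum_log_one_add_trace_le_log_det (A : ℕ → Matrix n n ℝ) (T : ℕ)
    (hA : ∀ t ∈ Icc 1 T, (A t).PosSemidef) :
    ∑ t ∈ Icc 1 T, log (1 + ((1 + ∑ s ∈ Icc 1 (t - 1), A s)⁻¹ * A t).trace)
      ≤ log (1 + ∑ s ∈ Icc 1 T, A s).det := by
  induction T with
  | zero => simp
  | succ T ih =>
    have hsub : ∀ t ∈ Icc 1 T, (A t).PosSemidef := fun t ht =>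
      hA t (Icc_subset_Icc_right (Nat.le_succ T) ht)
    have hlast := hA (T + 1) (by simp)
    have hV := posDef_one_add_sum hsub
    rw [Finset.sum_Icc_succ_top (by omega), Finset.sum_Icc_succ_top (by omega), ← add_assoc,
      Nat.add_sub_cancel]
    have hstep := hV.det_mul_one_add_trace_le hlast
    have hu := hV.inv.posSemidef.trace_mul_nonneg hlast
    have hlog := Real.log_le_log (mul_pos hV.det_pos (by linarith)) hstep
    rw [Real.log_mul hV.det_pos.ne' (by linarith)] at hlog
    linarith [ih hsub]

end Determinant

theorem min_one_le_two_mul_log_one_add {u : ℝ} (hu : 0 ≤ u) : min 1 u ≤ 2 * log (1 + u) := by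
  have hm : 0 ≤ min 1 u := le_min zero_le_one hu
  have h1 : 2 * min 1 u / (min 1 u + 2) ≤ log (1 + min 1 u) :=
    Real.le_log_one_add_of_nonneg hm
  have h2 : min 1 u / 2 ≤ 2 * min 1 u / (min 1 u + 2) := by
    rw [div_le_div_iff₀ (by norm_num) (by linarith)]
    nlinarith [min_le_left 1 u]
  have h3 : log (1 + min 1 u) ≤ log (1 + u) :=
    Real.log_le_log (by linarith) (by linarith [min_le_right 1 u])
  linarith

/-- A signed sum of vectors has Euclidean norm at most the sum of the norms. -/
theorem sqrt_sum_sq_sum_smul_le {n : Type*} [Fintype n] {ι : Type*} (s : Finset ι)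
    (ε : ι → ℝ) (w : ι → n → ℝ) (hε : ∀ j ∈ s, |ε j| ≤ 1) :
    √(∑ k, ((∑ j ∈ s, ε j • w j) k) ^ 2) ≤ ∑ j ∈ s, √(∑ k, (w j k) ^ 2) := by
  have hn : ∀ v : n → ℝ, √(∑ k, (v k) ^ 2) = ‖WithLp.toLp 2 v‖ := fun v => by
    simp [EuclideanSpace.norm_eq]
  simp only [hn, WithLp.toLp_sum, WithLp.toLp_smul]
  refine (norm_sum_le _ _).trans (Finset.sum_le_sum fun j hj => ?_)
  rw [norm_smul]
  exact mul_le_of_le_one_left (norm_nonneg _) (hε j hj)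

section Eluder

variable {n : Type*} [Fintype n]

/-- The weighted second-moment matrix `a • ∑ i, p i • x i (x i)ᵀ`. -/
noncomputable def secondMoment {ι : Type*} (s : Finset ι) (a : ℝ) (p : ι → ℝ)
    (x : ι → n → ℝ) : Matrix n n ℝ :=
  ∑ i ∈ s, (a * p i) • vecMulVec (x i) (x i)

variable {ι : Type*} {s : Finset ι} {a : ℝ} {p : ι → ℝ} (x : ι → n → ℝ)

theorem posSemidef_secondMoment (ha : 0 ≤ a) (hp : ∀ i ∈ s, 0 ≤ p i) :
    (secondMoment s a p x).PosSemidef :=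
  Matrix.posSemidef_sum s fun i hi =>
    Matrix.PosSemidef.smul (by simpa using Matrix.posSemidef_vecMulVec_self_star (x i))
      (mul_nonneg ha (hp i hi))

theorem trace_mul_secondMoment (M : Matrix n n ℝ) :
    (M * secondMoment s a p x).trace = a * ∑ i ∈ s, p i * (x i ⬝ᵥ M *ᵥ x i) := by
  simp only [secondMoment, Matrix.trace_sum, Matrix.mul_smul, Matrix.trace_smul,
    Matrix.mul_vecMulVec, Matrix.trace_vecMulVec, Finset.mul_sum, smul_eq_mul]
  exact Finset.sum_congr rfl fun i _ => by rw [dotProduct_comm]; ring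

theorem dotProduct_secondMoment_mulVec (v : n → ℝ) :
    v ⬝ᵥ secondMoment s a p x *ᵥ v = a * ∑ i ∈ s, p i * (v ⬝ᵥ x i) ^ 2 := by
  simp only [secondMoment, Matrix.sum_mulVec, dotProduct_sum, Matrix.smul_mulVec,
    dotProduct_smul, Matrix.vecMulVec_mulVec, Finset.mul_sum, smul_eq_mul]
  refine Finset.sum_congr rfl fun i _ => ?_
  simp [dotProduct_comm (x i) v]
  ring

/-- Signed Cauchy–Schwarz against the regularized second-moment matrix of past data. -/
theorem sq_sum_abs_dotProduct_le [DecidableEq n] {κ : Type*} {q : Finset κ} {τ : Finset ℕ}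
    {p : ℕ → ι → ℝ} (x : ℕ → ι → n → ℝ) (w : κ → n → ℝ) (y : n → ℝ) {B γ : ℝ} (ha : 0 ≤ a)
    (hp : ∀ t ∈ τ, ∀ i ∈ s, 0 ≤ p t i) (hw : ∑ j ∈ q, √(∑ k, (w j k) ^ 2) ≤ B)
    (hγ : ∑ t ∈ τ, ∑ i ∈ s, p t i * (∑ j ∈ q, |w j ⬝ᵥ x t i|) ^ 2 ≤ γ) :
    (∑ j ∈ q, |w j ⬝ᵥ y|) ^ 2 ≤ (B ^ 2 + a * γ) *
      (y ⬝ᵥ (1 + ∑ t ∈ τ, secondMoment s a (p t) (x t))⁻¹ *ᵥ y) := by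
  have hV : (1 + ∑ t ∈ τ, secondMoment s a (p t) (x t)).PosDef :=
    posDef_one_add_sum fun t ht => posSemidef_secondMoment (x t) ha (hp t ht)
  set ε : κ → ℝ := fun j => (SignType.sign (w j ⬝ᵥ y) : ℝ)
  obtain ⟨v, hv⟩ : ∃ v : n → ℝ, v = ∑ j ∈ q, ε j • w j := ⟨_, rfl⟩
  have hε : ∀ j, |ε j| ≤ 1 := fun j => by
    rcases lt_trichotomy (w j ⬝ᵥ y) 0 with h | h | h <;> simp [ε, h]
  have hvdot : ∀ z, v ⬝ᵥ z = ∑ j ∈ q, ε j * (w j ⬝ᵥ z) := fun z => by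
    simp [hv, sum_dotProduct, smul_dotProduct]
  have hvy : v ⬝ᵥ y = ∑ j ∈ q, |w j ⬝ᵥ y| := by
    rw [hvdot]
    exact Finset.sum_congr rfl fun j _ => sign_mul_self _
  have hvz : ∀ z, (v ⬝ᵥ z) ^ 2 ≤ (∑ j ∈ q, |w j ⬝ᵥ z|) ^ 2 := fun z => by
    rw [hvdot]
    refine sq_le_sq' (abs_le.mp ?_).1 (abs_le.mp ?_).2 <;>
    · refine (Finset.abs_sum_le_sum_abs _ _).trans (Finset.sum_le_sum fun j _ => ?_)
      rw [abs_mul]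
      exact mul_le_of_le_one_left (abs_nonneg _) (hε j)
  have hvv : v ⬝ᵥ v ≤ B ^ 2 := by
    have h0 : v ⬝ᵥ v = √(∑ k, (v k) ^ 2) ^ 2 := by
      rw [Real.sq_sqrt (Finset.sum_nonneg fun k _ => sq_nonneg _)]
      simp [dotProduct, sq]
    rw [h0, hv]
    exact pow_le_pow_left₀ (Real.sqrt_nonneg _)
      ((sqrt_sum_sq_sum_smul_le q ε w fun j _ => hε j).trans hw) 2
  have hVv : v ⬝ᵥ (1 + ∑ t ∈ τ, secondMoment s a (p t) (x t)) *ᵥ v ≤ B ^ 2 + a * γ := by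
    rw [Matrix.add_mulVec, Matrix.one_mulVec, dotProduct_add, Matrix.sum_mulVec, dotProduct_sum]
    simp only [dotProduct_secondMoment_mulVec]
    rw [← Finset.mul_sum]
    refine add_le_add hvv (mul_le_mul_of_nonneg_left (le_trans ?_ hγ) ha)
    exact Finset.sum_le_sum fun t ht => Finset.sum_le_sum fun i hi =>
      mul_le_mul_of_nonneg_left (hvz _) (hp t ht i hi)
  rw [← hvy]
  refine (hV.sq_dotProduct_le v y).trans (mul_le_mul_of_nonneg_right hVv ?_)
  simpa using hV.inv.posSemidef.dotProduct_mulVec_nonneg y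

end Eluder


/-- The ℓ₂ eluder technique: under the training-error, norm, and weight conditions,
`∑_{t=1}^T min { R, E_{i∼p_t} ∑_j |⟨w_{t,j}, x_{t,i}⟩| }`
is bounded by `√(2 d (R² T + ∑_t γ_t) log (1 + T R_x² R_w² / R²))`. -/
theorem l2_eluder_technique
    {d : ℕ} (hd : 1 ≤ d) (T J I : ℕ) (hT : 1 ≤ T) (hJ : 1 ≤ J) (hI : 1 ≤ I)
    (w : ℕ → ℕ → Fin d → ℝ) (x : ℕ → ℕ → Fin d → ℝ)
    (p : ℕ → ℕ → ℝ) (γ : ℕ → ℝ) (Rx Rw : ℝ)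
    (hp0 : ∀ t ∈ Finset.Icc 1 T, ∀ i ∈ Finset.Icc 1 I, 0 ≤ p t i)
    (hp1 : ∀ t ∈ Finset.Icc 1 T, ∑ i ∈ Finset.Icc 1 I, p t i = 1)
    (hγ : ∀ t ∈ Finset.Icc 1 T, 0 ≤ γ t) (hRx : 0 ≤ Rx) (hRw : 0 ≤ Rw)
    (h1 : ∀ t ∈ Finset.Icc 1 T,
      ∑ s ∈ Finset.Icc 1 (t - 1), ∑ i ∈ Finset.Icc 1 I,
        p s i * (∑ j ∈ Finset.Icc 1 J, |dotProduct (w t j) (x s i)|) ^ 2 ≤ γ t)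
    (h2 : ∀ t ∈ Finset.Icc 1 T,
      ∑ i ∈ Finset.Icc 1 I, p t i * (∑ k, (x t i k) ^ 2) ≤ Rx ^ 2)
    (h3 : ∀ t ∈ Finset.Icc 1 T,
      ∑ j ∈ Finset.Icc 1 J, Real.sqrt (∑ k, (w t j k) ^ 2) ≤ Rw)
    (R : ℝ) (hR : 0 < R) :
    ∑ t ∈ Finset.Icc 1 T,
        min R (∑ i ∈ Finset.Icc 1 I,
          p t i * ∑ j ∈ Finset.Icc 1 J, |dotProduct (w t j) (x t i)|)
      ≤ Real.sqrt (2 * d * (R ^ 2 * T + ∑ t ∈ Finset.Icc 1 T, γ t)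
          * Real.log (1 + T * Rx ^ 2 * Rw ^ 2 / R ^ 2)) := by
  have hJ0 : ∀ t ∈ Icc 1 T, ∀ i, 0 ≤ ∑ j ∈ Icc 1 J, |w t j ⬝ᵥ x t i| :=
    fun t _ i => Finset.sum_nonneg fun j _ => abs_nonneg _
  have hQ0 : ∀ t ∈ Icc 1 T, 0 ≤ ∑ i ∈ Icc 1 I, p t i * ∑ j ∈ Icc 1 J, |w t j ⬝ᵥ x t i| :=
    fun t ht => Finset.sum_nonneg fun i hi => mul_nonneg (hp0 t ht i hi) (hJ0 t ht i)
  rcases hRw.eq_or_lt with rfl | hRw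
  · have hw0 : ∀ t ∈ Icc 1 T, ∀ j ∈ Icc 1 J, w t j = 0 := by
      intro t ht j hj
      have h := (Finset.single_le_sum (f := fun j => √(∑ k, (w t j k) ^ 2))
        (fun j _ => Real.sqrt_nonneg _) hj).trans (h3 t ht)
      have h' := Real.sqrt_eq_zero'.mp (le_antisymm h (Real.sqrt_nonneg _))
      have h'' := (Finset.sum_eq_zero_iff_of_nonneg fun k _ => sq_nonneg (w t j k)).mp
        (le_antisymm h' (Finset.sum_nonneg fun k _ => sq_nonneg _))
      ext k
      simpa using h'' k (mem_univ k)
    refine le_trans (Finset.sum_nonpos fun t ht => ?_) (Real.sqrt_nonneg _)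
    refine (min_le_right _ _).trans (Finset.sum_nonpos fun i _ => ?_)
    rw [Finset.sum_eq_zero fun j hj => by rw [hw0 t ht j hj, zero_dotProduct, abs_zero], mul_zero]
  set a : ℝ := Rw ^ 2 / R ^ 2 with ha_def
  have ha : 0 < a := by positivity
  have haR : Rw ^ 2 = a * R ^ 2 := by rw [ha_def]; field_simp
  set A : ℕ → Matrix (Fin d) (Fin d) ℝ := fun t => secondMoment (Icc 1 I) a (p t) (x t)
  have hA : ∀ t ∈ Icc 1 T, (A t).PosSemidef := fun t ht =>
    posSemidef_secondMoment (x t) ha.le (hp0 t ht)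
  have hpast : ∀ t ∈ Icc 1 T, ∀ r ∈ Icc 1 (t - 1), r ∈ Icc 1 T := by
    intro t ht r hr
    simp only [Finset.mem_Icc] at ht hr ⊢
    omega
  set u : ℕ → ℝ := fun t => ((1 + ∑ r ∈ Icc 1 (t - 1), A r)⁻¹ * A t).trace with hu_def
  have hu : ∀ t ∈ Icc 1 T, 0 ≤ u t := fun t ht =>
    (posDef_one_add_sum fun r hr => hA r (hpast t ht r hr)).inv.posSemidef.trace_mul_nonneg (hA t ht)
  have hround : ∀ t ∈ Icc 1 T,
      (∑ i ∈ Icc 1 I, p t i * ∑ j ∈ Icc 1 J, |w t j ⬝ᵥ x t i|) ^ 2 ≤ (R ^ 2 + γ t) * u t := by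
    intro t ht
    refine (Real.pow_arith_mean_le_arith_mean_pow _ _ _ (hp0 t ht) (hp1 t ht)
      (fun i _ => hJ0 t ht i) 2).trans ?_
    have hi : ∀ i ∈ Icc 1 I, p t i * (∑ j ∈ Icc 1 J, |w t j ⬝ᵥ x t i|) ^ 2 ≤
        p t i * ((Rw ^ 2 + a * γ t) *
          (x t i ⬝ᵥ (1 + ∑ r ∈ Icc 1 (t - 1), A r)⁻¹ *ᵥ x t i)) := fun i hi =>
      mul_le_mul_of_nonneg_left (sq_sum_abs_dotProduct_le x (w t) (x t i) ha.le
        (fun r hr => hp0 r (hpast t ht r hr)) (h3 t ht) (h1 t ht)) (hp0 t ht i hi)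
    refine (Finset.sum_le_sum hi).trans_eq ?_
    rw [hu_def]
    simp only [A, trace_mul_secondMoment, haR, Finset.mul_sum]
    exact Finset.sum_congr rfl fun i _ => by ring
  have hmin : ∀ t ∈ Icc 1 T,
      (min R (∑ i ∈ Icc 1 I, p t i * ∑ j ∈ Icc 1 J, |w t j ⬝ᵥ x t i|)) ^ 2
        ≤ (R ^ 2 + γ t) * min 1 (u t) := by
    intro t ht
    have hm := le_min hR.le (hQ0 t ht)
    rw [mul_min_of_nonneg _ _ (by nlinarith [hγ t ht])]
    refine le_min ?_ ((pow_le_pow_left₀ hm (min_le_right _ _) 2).trans (hround t ht))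
    nlinarith [pow_le_pow_left₀ hm (min_le_left _ _) 2, hγ t ht]
  have hpot : ∑ t ∈ Icc 1 T, min 1 (u t)
      ≤ 2 * (d * Real.log (1 + T * Rx ^ 2 * Rw ^ 2 / R ^ 2)) := by
    have hS : (∑ t ∈ Icc 1 T, A t).PosSemidef := Matrix.posSemidef_sum _ hA
    have htr : (∑ t ∈ Icc 1 T, A t).trace ≤ T * Rx ^ 2 * Rw ^ 2 / R ^ 2 := by
      have hAt : ∀ t ∈ Icc 1 T, (A t).trace ≤ a * Rx ^ 2 := by
        intro t ht
        have h := trace_mul_secondMoment (s := Icc 1 I) (a := a) (p := p t) (x t) 1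
        rw [one_mul] at h
        refine h.trans_le (mul_le_mul_of_nonneg_left (le_trans (le_of_eq ?_) (h2 t ht)) ha.le)
        simp [dotProduct, sq]
      rw [Matrix.trace_sum]
      refine (Finset.sum_le_sum hAt).trans_eq ?_
      simp [ha_def]
      ring
    have hdet : Real.log (1 + ∑ t ∈ Icc 1 T, A t).det
        ≤ d * Real.log (1 + T * Rx ^ 2 * Rw ^ 2 / R ^ 2) := by
      rw [← Real.log_pow]
      refine Real.log_le_log (posDef_one_add_sum hA).det_pos (hS.det_one_add_le.trans ?_)
      rw [Fintype.card_fin]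
      exact pow_le_pow_left₀ (by linarith [hS.trace_nonneg]) (by linarith) d
    refine (Finset.sum_le_sum fun t ht => min_one_le_two_mul_log_one_add (hu t ht)).trans ?_
    rw [← Finset.mul_sum]
    linarith [sum_log_one_add_trace_le_log_det A T hA]
  refine Real.le_sqrt_of_sq_le ?_
  have hG : ∀ t ∈ Icc 1 T, 0 ≤ R ^ 2 + γ t := fun t ht => by nlinarith [hγ t ht]
  refine (Finset.sum_sq_le_sum_mul_sum_of_sq_le_mul _ hG
    (fun t ht => le_min zero_le_one (hu t ht)) hmin).trans ?_
  refine (mul_le_mul_of_nonneg_left hpot (Finset.sum_nonneg hG)).trans_eq ?_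
  rw [Finset.sum_add_distrib]
  simp
  ring
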